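/- Let G=(L,R;E) be a bipartite graph that has at least one identifiable ℓ-subgraph. Then the set J⊆L of maximum cardinality such that G(J) is identifiable is unique; that is, if J₁ and J₂ both induce identifiable ℓ-subgraphs of G and both have maximum cardinality among all such sets, then J₁=J₂. -/

import Mathlib

open Finset

/-- A (bipartitioned) bipartite graph on a finite ambient vertex type `V`:
two disjoint finite vertex sets `L` and `R`, and an adjacency relation
(oriented from `L` to `R`) all of whose edges join a vertex of `L`
to a vertex of `R`. -/
structure BipGraph (V : Type*) [DecidableEq V] [Fintype V] where
  L : Finset V
  R : Finset V
  disj : Disjoint L R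
  adj : V → V → Bool
  adj_mem : ∀ u v, adj u v = true → u ∈ L ∧ v ∈ R

namespace BipGraph

variable {V : Type*} [DecidableEq V] [Fintype V]

/-- `N(X)`: the set of vertices of `R` having a neighbor in `X`. -/
def nbhd (G : BipGraph V) (X : Finset V) : Finset V :=
  G.R.filter (fun r => ∃ x ∈ X, G.adj x r = true)

/-- A matching of `A` into `S`: an injective assignment matching every vertex
of `A` to an adjacent vertex of `S`. -/
def HasMatchingInto (G : BipGraph V) (A S : Finset V) : Prop :=
  ∃ f : V → V, Set.InjOn f ↑A ∧ ∀ a ∈ A, f a ∈ S ∧ G.adj a (f a) = true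

/-- `G = (L,R;E)` is identifiable if `E ≠ ∅` and for every `v ∈ L` there is a
matching (necessarily of cardinality `|L| - 1`) of `L \ {v}` into `R \ N(v)`. -/
def Identifiable (G : BipGraph V) : Prop :=
  (∃ u v, G.adj u v = true) ∧
    ∀ v ∈ G.L, G.HasMatchingInto (G.L.erase v) (G.R \ G.nbhd {v})

/-- The ℓ-subgraph of `G` induced by `J ⊆ L`: the induced subgraph
`G[J, R \ N(L \ J)]`. -/
def lSub (G : BipGraph V) (J : Finset V) : BipGraph V where
  L := J ∩ G.L
  R := G.R \ G.nbhd (G.L \ J)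
  disj := G.disj.mono inter_subset_right sdiff_subset
  adj := fun u v =>
    decide (u ∈ J ∩ G.L) && decide (v ∈ G.R \ G.nbhd (G.L \ J)) && G.adj u v
  adj_mem := by
    intro u v h
    simp only [Bool.and_eq_true, decide_eq_true_eq] at h
    exact ⟨h.1.1, h.1.2⟩

end BipGraph

namespace BipGraph

variable {V : Type*} [DecidableEq V] [Fintype V] {G : BipGraph V} {J J₁ J₂ : Finset V}

theorem lSub_adj_iff {u r : V} :
    (G.lSub J).adj u r = true ↔
      G.adj u r = true ∧ ∀ x, G.adj x r = true → x ∈ J := by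
  simp only [lSub, nbhd, Bool.and_eq_true, decide_eq_true_eq, mem_inter, mem_sdiff, mem_filter]
  constructor
  · rintro ⟨⟨-, hr, hn⟩, h⟩
    refine ⟨h, fun x hx => ?_⟩
    by_contra hxJ
    exact hn ⟨hr, x, ⟨(G.adj_mem x r hx).1, hxJ⟩, hx⟩
  · rintro ⟨h, hall⟩
    refine ⟨⟨⟨hall u h, (G.adj_mem u r h).1⟩, (G.adj_mem u r h).2, ?_⟩, h⟩
    rintro ⟨-, x, ⟨-, hxJ⟩, hx⟩
    exact hxJ (hall x hx)

theorem identifiable_iff : G.Identifiable ↔ (∃ u r, G.adj u r = true) ∧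
    ∀ v ∈ G.L, ∃ f : V → V, Set.InjOn f ↑(G.L.erase v) ∧
      ∀ a ∈ G.L.erase v, G.adj a (f a) = true ∧ ¬ G.adj v (f a) = true := by
  unfold Identifiable HasMatchingInto
  refine and_congr_right fun _ => forall₂_congr fun v _ => exists_congr fun f =>
    and_congr_right fun _ => forall₂_congr fun a _ => ?_
  simp only [nbhd, mem_sdiff, mem_filter, mem_singleton, exists_eq_left]
  constructor
  · rintro ⟨⟨hr, hn⟩, h⟩
    exact ⟨h, fun hv => hn ⟨hr, hv⟩⟩
  · rintro ⟨h, hn⟩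
    exact ⟨⟨(G.adj_mem _ _ h).2, fun hv => hn hv.2⟩, h⟩

/-- The left side of an identifiable graph can be matched completely. -/
theorem Identifiable.exists_matching (hG : G.Identifiable) :
    ∃ f : V → V, Set.InjOn f ↑G.L ∧ ∀ a ∈ G.L, G.adj a (f a) = true := by
  obtain ⟨⟨u, r, hur⟩, h⟩ := identifiable_iff.1 hG
  obtain ⟨f, hf, hadj⟩ := h u (G.adj_mem u r hur).1
  simp only [mem_erase] at hadj
  have hne : ∀ a ∈ G.L, a ≠ u → f a ≠ r := fun a ha hau e =>
    (hadj a ⟨hau, ha⟩).2 (e ▸ hur)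
  refine ⟨fun a => if a = u then r else f a, ?_, ?_⟩
  · intro a ha b hb hab
    rw [mem_coe] at ha hb
    dsimp only at hab
    split_ifs at hab with h₁ h₂ h₂
    · rw [h₁, h₂]
    · exact absurd hab.symm (hne b hb h₂)
    · exact absurd hab (hne a ha h₁)
    · exact hf (by simp [h₁, ha]) (by simp [h₂, hb]) hab
  · intro a ha
    dsimp only
    split_ifs with h₁
    · exact h₁ ▸ hur
    · exact (hadj a ⟨h₁, ha⟩).1

/-- If `G(J)` is identifiable, then for every `v`, in `J` or not, `J \ {v}` can be matched in
`G(J)` into the non-neighbors of `v` in `G`. -/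
theorem Identifiable.exists_matching_erase (hJ : J ⊆ G.L) (h : (G.lSub J).Identifiable) (v : V) :
    ∃ f : V → V, Set.InjOn f ↑(J.erase v) ∧
      ∀ a ∈ J.erase v, (G.lSub J).adj a (f a) = true ∧ ¬ G.adj v (f a) = true := by
  have hL : (G.lSub J).L = J := inter_eq_left.2 hJ
  by_cases hv : v ∈ J
  · obtain ⟨f, hf, hadj⟩ := (identifiable_iff.1 h).2 v (hL.symm ▸ hv)
    rw [hL] at hf hadj
    refine ⟨f, hf, fun a ha => ⟨(hadj a ha).1, fun hva => (hadj a ha).2 ?_⟩⟩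
    exact lSub_adj_iff.2 ⟨hva, (lSub_adj_iff.1 (hadj a ha).1).2⟩
  · obtain ⟨f, hf, hadj⟩ := h.exists_matching
    rw [hL] at hf hadj
    rw [erase_eq_of_notMem hv]
    exact ⟨f, hf, fun a ha => ⟨hadj a ha, fun hva =>
      hv ((lSub_adj_iff.1 (hadj a ha)).2 v hva)⟩⟩

/-- Sets inducing identifiable ℓ-subgraphs are closed under union. -/
theorem Identifiable.lSub_union (hJ₁ : J₁ ⊆ G.L) (hJ₂ : J₂ ⊆ G.L)
    (h₁ : (G.lSub J₁).Identifiable) (h₂ : (G.lSub J₂).Identifiable) :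
    (G.lSub (J₁ ∪ J₂)).Identifiable := by
  have hL : (G.lSub (J₁ ∪ J₂)).L = J₁ ∪ J₂ := inter_eq_left.2 (union_subset hJ₁ hJ₂)
  rw [identifiable_iff, hL]
  simp only [lSub_adj_iff]
  refine ⟨?_, fun v _ => ?_⟩
  · obtain ⟨u, r, hur⟩ := h₁.1
    rw [lSub_adj_iff] at hur
    exact ⟨u, r, hur.1, fun x hx => mem_union_left _ (hur.2 x hx)⟩
  · obtain ⟨f, hf, hfadj⟩ := h₁.exists_matching_erase hJ₁ v
    obtain ⟨g, hg, hgadj⟩ := h₂.exists_matching_erase hJ₂ v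
    simp only [lSub_adj_iff, mem_erase] at hfadj
    simp only [lSub_adj_iff, mem_erase] at hgadj
    have hne : ∀ a ∈ J₁, a ≠ v → ∀ b ∈ J₂, b ≠ v → b ∉ J₁ → f a ≠ g b :=
      fun a ha hav b hb hbv hbJ e =>
        hbJ ((hfadj a ⟨hav, ha⟩).1.2 b (e ▸ (hgadj b ⟨hbv, hb⟩).1.1))
    refine ⟨fun a => if a ∈ J₁ then f a else g a, ?_, ?_⟩
    · intro a ha b hb hab
      simp only [mem_coe, mem_erase, mem_union] at ha hb
      dsimp only at hab
      split_ifs at hab with ha₁ hb₁ hb₁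
      · exact hf (by simp [ha₁, ha.1]) (by simp [hb₁, hb.1]) hab
      · exact absurd hab (hne a ha₁ ha.1 b (hb.2.resolve_left hb₁) hb.1 hb₁)
      · exact absurd hab.symm (hne b hb₁ hb.1 a (ha.2.resolve_left ha₁) ha.1 ha₁)
      · exact hg (by simp [ha.2.resolve_left ha₁, ha.1])
          (by simp [hb.2.resolve_left hb₁, hb.1]) hab
    · intro a ha
      simp only [mem_erase, mem_union] at ha
      dsimp only
      split_ifs with ha₁
      · obtain ⟨⟨h, hall⟩, hn⟩ := hfadj a ⟨ha.1, ha₁⟩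
        exact ⟨⟨h, fun x hx => mem_union_left _ (hall x hx)⟩, fun hv => hn hv.1⟩
      · obtain ⟨⟨h, hall⟩, hn⟩ := hgadj a ⟨ha.1, ha.2.resolve_left ha₁⟩
        exact ⟨⟨h, fun x hx => mem_union_right _ (hall x hx)⟩, fun hv => hn hv.1⟩

end BipGraph

/-- If a bipartite graph `G` has at least one identifiable ℓ-subgraph, then the
set `J ⊆ L` of maximum cardinality such that `G(J)` is identifiable is unique. -/
theorem stmt7 {V : Type*} [DecidableEq V] [Fintype V] (G : BipGraph V)
    (h : ∃ J ⊆ G.L, (G.lSub J).Identifiable) :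
    ∀ J₁ ⊆ G.L, ∀ J₂ ⊆ G.L,
      (G.lSub J₁).Identifiable → (G.lSub J₂).Identifiable →
      (∀ J ⊆ G.L, (G.lSub J).Identifiable → J.card ≤ J₁.card) →
      (∀ J ⊆ G.L, (G.lSub J).Identifiable → J.card ≤ J₂.card) →
      J₁ = J₂ := by
  intro J₁ hJ₁ J₂ hJ₂ h₁ h₂ hmax₁ hmax₂
  have hJ := union_subset hJ₁ hJ₂
  have hU := h₁.lSub_union hJ₁ hJ₂ h₂
  exact (eq_of_subset_of_card_le subset_union_left (hmax₁ _ hJ hU)).trans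
    (eq_of_subset_of_card_le subset_union_right (hmax₂ _ hJ hU)).symm
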